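/- arXiv:math/0212244 — 3 statements merged into one kernel-verified Lean document; each statement's English description precedes it below -/
import Mathlib

section
/- Let f, g : Fin (n+1) → EuclideanSpace ℝ (Fin (n+1)) be two linearly independent families of unit vectors such that for all i ≠ j one has |⟪f i, f j⟫| = |⟪g i, g j⟫| and |⟪f i, f j⟫| ∈ {0, 1/2, √2/2}. Then there exists a sign function ε : Fin (n+1) → {−1, 1} such that ⟪g i, g j⟫ = ε i · ε j · ⟪f i, f j⟫ for all i, j. In other words, the unsigned Gram matrix (with entries of these sizes) determines the family of spherical simplices ±f_1, …, ±f_{n+1} uniquely up to isometry. -/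
open scoped RealInnerProductSpace

/-- Signed walks of length `k` from `u` to `v` with total sign `t`. -/
def SWalk {V : Type} (E : V → V → Prop) (s : V → V → ℤˣ) : ℕ → V → V → ℤˣ → Prop
  | 0, u, v, t => u = v ∧ t = 1
  | k + 1, u, v, t => ∃ r, E u r ∧ SWalk E s k r v (s u r * t)

section
variable {V : Type} {E : V → V → Prop} {s : V → V → ℤˣ}

theorem SWalk.trans {a b : ℕ} {u v w : V} {t t' : ℤˣ} (h : SWalk E s a u v t)
    (h' : SWalk E s b v w t') : SWalk E s (a + b) u w (t * t') := by
  induction a generalizing u t with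
  | zero =>
    obtain ⟨rfl, rfl⟩ := h
    simpa using h'
  | succ a ih =>
    obtain ⟨r, hr, h1⟩ := h
    rw [Nat.add_right_comm]
    exact ⟨r, hr, by simpa [mul_assoc] using ih h1⟩

theorem SWalk.single {u v : V} (h : E u v) : SWalk E s 1 u v (s u v) :=
  ⟨v, h, rfl, Int.units_mul_self _⟩

theorem SWalk.symm (hE : ∀ u v, E u v → E v u) (hs : ∀ u v, s u v = s v u)
    {a : ℕ} {u v : V} {t : ℤˣ} (h : SWalk E s a u v t) : SWalk E s a v u t := by
  induction a generalizing u t with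
  | zero =>
    obtain ⟨rfl, rfl⟩ := h
    exact ⟨rfl, rfl⟩
  | succ a ih =>
    obtain ⟨r, hr, h1⟩ := h
    have := (ih h1).trans (SWalk.single (s := s) (hE _ _ hr))
    rw [hs r u, mul_comm (s u r) t, mul_assoc, Int.units_mul_self, mul_one] at this
    exact this

theorem SWalk.exists_fun {k : ℕ} {u v : V} {t : ℤˣ} (h : SWalk E s k u v t) :
    ∃ (c : ℕ → V) (a : ℕ → ℤˣ), c 0 = u ∧ c k = v ∧ a 0 = 1 ∧ a k = t ∧
      ∀ i, i < k → E (c i) (c (i + 1)) ∧ a (i + 1) = a i * s (c i) (c (i + 1)) := by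
  induction k generalizing u t with
  | zero =>
    obtain ⟨rfl, rfl⟩ := h
    exact ⟨fun _ => u, fun _ => 1, rfl, rfl, rfl, rfl, by simp⟩
  | succ k ih =>
    obtain ⟨r, hr, h1⟩ := h
    obtain ⟨c, a, h0, hk, ha0, hak, hc⟩ := ih h1
    refine ⟨fun i => Nat.casesOn i u c, fun i => Nat.casesOn i 1 (fun j => s u r * a j),
      rfl, hk, rfl, ?_, ?_⟩
    · change s u r * a k = t
      rw [hak, ← mul_assoc, Int.units_mul_self, one_mul]
    · intro i hi
      cases i with
      | zero =>
        change E u (c 0) ∧ s u r * a 0 = 1 * s u (c 0)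
        rw [h0, ha0]
        exact ⟨hr, by simp⟩
      | succ i =>
        obtain ⟨h2, h3⟩ := hc i (by omega)
        exact ⟨h2, by
          change s u r * a (i + 1) = s u r * a i * _
          rw [h3, mul_assoc]⟩

theorem SWalk.of_fun {k : ℕ} {c : ℕ → V} {a : ℕ → ℤˣ}
    (hc : ∀ i, i < k → E (c i) (c (i + 1)) ∧ a (i + 1) = a i * s (c i) (c (i + 1)))
    (i d : ℕ) (hd : i + d ≤ k) : SWalk E s d (c i) (c (i + d)) (a i * a (i + d)) := by
  induction d with
  | zero => exact ⟨rfl, Int.units_mul_self _⟩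
  | succ d ih =>
    have h1 := ih (by omega)
    obtain ⟨h2, h3⟩ := hc (i + d) (by omega)
    have := h1.trans (SWalk.single (s := s) h2)
    rw [mul_assoc, ← h3] at this
    exact this

/-- An unbalanced signed graph contains an unbalanced induced cycle. -/
theorem exists_induced_cycle (hE : ∀ u v, E u v → E v u) (hs : ∀ u v, s u v = s v u)
    (hirr : ∀ u, ¬ E u u) (hub : ∃ k u, SWalk E s k u u (-1)) :
    ∃ (m : ℕ) (c : ℕ → V) (a : ℕ → ℤˣ), 2 ≤ m ∧ a 0 = 1 ∧
      (∀ i, i < m → E (c i) (c (i + 1)) ∧ a (i + 1) = a i * s (c i) (c (i + 1))) ∧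
      E (c m) (c 0) ∧ a m * s (c m) (c 0) = -1 ∧
      (∀ i j, i < j → j ≤ m → c i ≠ c j) ∧
      (∀ i j, i + 2 ≤ j → j ≤ m → E (c i) (c j) → i = 0 ∧ j = m) := by
  classical
  have hmin := fun m => Nat.find_min' (m := m) hub
  obtain ⟨u, hu⟩ := Nat.find_spec hub
  generalize Nat.find hub = k at hmin hu
  obtain ⟨c, a, h0, hk, ha0, hak, hc⟩ := hu.exists_fun
  have hsub : ∀ i j, i ≤ j → j ≤ k → SWalk E s (j - i) (c i) (c j) (a i * a j) := by
    intro i j hij hj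
    obtain ⟨d, rfl⟩ := Nat.exists_eq_add_of_le hij
    simpa using SWalk.of_fun hc i d hj
  obtain _ | _ | _ | m := k
  · rw [ha0] at hak
    exact absurd hak (by decide)
  · have := (hc 0 (by omega)).1
    rw [h0] at this
    simp only [zero_add] at this hk
    rw [hk] at this
    exact absurd this (hirr _)
  · have h1 := (hc 0 (by omega)).2
    have h2 := (hc 1 (by omega)).2
    simp only [zero_add, Nat.reduceAdd] at h1 h2 hk hak
    rw [h1, ha0, h0, hk, one_mul, hs (c 1) u, Int.units_mul_self, hak] at h2
    exact absurd h2 (by decide)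
  · have hlast := hc (m + 2) (by omega)
    simp only [Nat.add_assoc, Nat.reduceAdd] at *
    rw [hk, hak] at hlast
    refine ⟨m + 2, c, a, by omega, ha0, fun i hi => hc i (by omega), by rw [h0]; exact hlast.1,
      by rw [h0]; exact hlast.2.symm, ?_, ?_⟩
    · intro i j hij hj hcc
      have w1 := hsub i j hij.le (by omega)
      have w2 := (hsub 0 i (by omega) (by omega))
      have w3 := (hsub j (m + 3) (by omega) (by omega))
      rcases Int.units_eq_one_or (a i * a j) with h | h
      · rw [hcc] at w2
        have w := w2.trans w3
        rw [h0, hk, ha0, hak, one_mul, ← mul_assoc, h, one_mul] at w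
        have := hmin _ ⟨_, w⟩
        omega
      · rw [hcc, h] at w1
        have := hmin _ ⟨_, w1⟩
        omega
    · intro i j hij hj he
      have w1 := hsub i j (by omega) (by omega)
      have w2 := (hsub 0 i (by omega) (by omega))
      have w3 := (hsub j (m + 3) (by omega) (by omega))
      rcases Int.units_eq_one_or (a i * a j * s (c j) (c i)) with h | h
      · have w := (w2.trans (SWalk.single (s := s) he)).trans w3
        have e : a 0 * a i * s (c i) (c j) * (a j * a (m + 3)) = -1 := by
          rw [hs, ha0, hak]
          calc _ = (a i * a j * s (c j) (c i)) * (-1) := by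
                rw [one_mul]; ac_rfl
            _ = -1 := by rw [h, one_mul]
        rw [e, h0, hk] at w
        have := hmin _ ⟨_, w⟩
        omega
      · have w := w1.trans (SWalk.single (s := s) (hE _ _ he))
        rw [h] at w
        have := hmin _ ⟨_, w⟩
        omega

/-- A balanced signed graph is switching-trivial. -/
theorem exists_switch (hE : ∀ u v, E u v → E v u) (hs : ∀ u v, s u v = s v u)
    (hb : ¬ ∃ k u, SWalk E s k u u (-1)) :
    ∃ e : V → ℤˣ, ∀ u v, E u v → s u v = e u * e v := by
  classical
  let S : Setoid V :=
    { r := fun u v => ∃ k t, SWalk E s k u v t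
      iseqv :=
        { refl := fun u => ⟨0, 1, rfl, rfl⟩
          symm := fun ⟨k, t, h⟩ => ⟨k, t, h.symm hE hs⟩
          trans := fun ⟨k, t, h⟩ ⟨k', t', h'⟩ => ⟨_, _, h.trans h'⟩ } }
  have key : ∀ v : V, ∃ t k, SWalk E s k (Quotient.mk S v).out v t := by
    intro v
    obtain ⟨k, t, h⟩ := Quotient.mk_out (s := S) v
    exact ⟨t, k, h⟩
  choose e ke he using key
  refine ⟨e, fun u v huv => ?_⟩
  have hq : Quotient.mk S u = Quotient.mk S v :=
    Quotient.sound ⟨1, _, SWalk.single huv⟩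
  have h1 := he u
  rw [hq] at h1
  have h2 := (h1.trans (SWalk.single (s := s) huv)).trans ((he v).symm hE hs)
  rcases Int.units_eq_one_or (e u * s u v * e v) with h | h
  · calc s u v = (e u * e u) * s u v * (e v * e v) := by simp [Int.units_mul_self]
      _ = (e u * s u v * e v) * (e u * e v) := by ac_rfl
      _ = _ := by rw [h, one_mul]
  · rw [h] at h2
    exact absurd ⟨_, _, h2⟩ hb
end

/-- On an induced cycle of unit vectors with nonzero products of size at least one half, the sign
of the closing edge is forced. -/
theorem cycle_sign {V H : Type} [NormedAddCommGroup H] [InnerProductSpace ℝ H]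
    (f : V → H) (hli : LinearIndependent ℝ f) (hu : ∀ i, ‖f i‖ = 1)
    (m : ℕ) (hm : 2 ≤ m) (c : ℕ → V)
    (hinj : ∀ i j, i < j → j ≤ m → c i ≠ c j)
    (hstep : ∀ i, i < m → 1 / 2 ≤ |⟪f (c i), f (c (i + 1))⟫|)
    (hlast : 1 / 2 ≤ |⟪f (c m), f (c 0)⟫|)
    (hch : ∀ i j, i + 2 ≤ j → j ≤ m → ⟪f (c i), f (c j)⟫ ≠ 0 → i = 0 ∧ j = m)
    (η : ℕ → ℝ) (hη : ∀ i, i ≤ m → η i = 1 ∨ η i = -1)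
    (hη' : ∀ i, i < m → η i * η (i + 1) * ⟪f (c i), f (c (i + 1))⟫ < 0) :
    0 < η 0 * η m * ⟪f (c m), f (c 0)⟫ := by
  have hsq : ∀ i, i ≤ m → η i * η i = 1 := by
    intro i hi
    rcases hη i hi with h | h <;> rw [h] <;> norm_num
  have habs : ∀ i j, i ≤ m → j ≤ m → |η i * η j| = 1 := by
    intro i j hi hj
    rcases hη i hi with h | h <;> rcases hη j hj with h' | h' <;> rw [h, h'] <;> norm_num
  have hstep' : ∀ i, i < m → η i * η (i + 1) * ⟪f (c i), f (c (i + 1))⟫ ≤ -(1 / 2) := by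
    intro i hi
    have h1 := hstep i hi
    have h2 : |η i * η (i + 1) * ⟪f (c i), f (c (i + 1))⟫| = |⟪f (c i), f (c (i + 1))⟫| := by
      rw [abs_mul, habs i (i + 1) hi.le hi, one_mul]
    rw [abs_of_neg (hη' i hi)] at h2
    linarith
  let S : ℕ → H := fun k => ∑ i ∈ Finset.range k, η i • f (c i)
  have hexp : ∀ k, k ≤ m → ‖S (k + 1)‖ ^ 2 = ‖S k‖ ^ 2 +
      2 * (∑ i ∈ Finset.range k, η i * η k * ⟪f (c i), f (c k)⟫) + 1 := by
    intro k hk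
    have h1 : S (k + 1) = S k + η k • f (c k) := Finset.sum_range_succ _ _
    have h2 : ‖η k • f (c k)‖ = 1 := by
      rw [norm_smul, hu, mul_one]
      rcases hη k hk with h | h <;> rw [h] <;> norm_num
    rw [h1, norm_add_sq_real, h2]
    have h3 : ⟪S k, η k • f (c k)⟫ = ∑ i ∈ Finset.range k, η i * η k * ⟪f (c i), f (c k)⟫ := by
      simp only [S]
      rw [sum_inner]
      refine Finset.sum_congr rfl fun i _ => ?_
      rw [real_inner_smul_left, real_inner_smul_right]
      ring
    rw [h3]
    ring
  have hle : ∀ k, k < m → ‖S (k + 1)‖ ^ 2 ≤ 1 := by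
    intro k hk
    induction k with
    | zero =>
      rw [hexp 0 (by omega)]
      simp [S]
    | succ k ih =>
      have h1 := ih (by omega)
      rw [hexp (k + 1) hk.le, Finset.sum_range_succ]
      have h2 : ∑ i ∈ Finset.range k, η i * η (k + 1) * ⟪f (c i), f (c (k + 1))⟫ = 0 := by
        refine Finset.sum_eq_zero fun i hi => ?_
        have hi' := Finset.mem_range.1 hi
        by_contra h
        have := hch i (k + 1) (by omega) hk.le (right_ne_zero_of_mul h)
        omega
      have h3 := hstep' k (by omega)
      rw [h2]
      linarith
  have hne : S (m + 1) ≠ 0 := by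
    intro h0
    have hli' : LinearIndependent ℝ (fun i : Fin (m + 1) => f (c i)) := by
      refine hli.comp (fun i : Fin (m + 1) => c i) ?_
      intro i j hij
      by_contra hne
      rcases lt_or_gt_of_ne (fun h => hne (Fin.ext h) : (i : ℕ) ≠ j) with h | h
      · exact hinj i j h (by omega) hij
      · exact hinj j i h (by omega) hij.symm
    have h1 := (Fintype.linearIndependent_iff.1 hli') (fun i => η i)
      (by rw [← h0]; exact Fin.sum_univ_eq_sum_range (fun i => η i • f (c i)) (m + 1)) 0
    have h2 := hsq 0 (by omega)
    simp only [Fin.val_zero] at h1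
    rw [h1] at h2
    norm_num at h2
  have hpos : 0 < ‖S (m + 1)‖ ^ 2 := by
    have := norm_pos_iff.2 hne
    positivity
  rw [hexp m le_rfl] at hpos
  obtain ⟨m, rfl⟩ : ∃ p, m = p + 2 := ⟨m - 2, by omega⟩
  rw [Finset.sum_range_succ, Finset.sum_range_succ'] at hpos
  have h2 : ∑ i ∈ Finset.range m, η (i + 1) * η (m + 2) * ⟪f (c (i + 1)), f (c (m + 2))⟫ = 0 := by
    refine Finset.sum_eq_zero fun i hi => ?_
    have hi' := Finset.mem_range.1 hi
    by_contra h
    have := hch (i + 1) (m + 2) (by omega) le_rfl (right_ne_zero_of_mul h)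
    omega
  rw [h2, real_inner_comm] at hpos
  have h3 := hstep' (m + 1) (by omega)
  have h4 := hle (m + 1) (by omega)
  by_contra hcon
  have h5 : |η 0 * η (m + 2) * ⟪f (c (m + 2)), f (c 0)⟫| = |⟪f (c (m + 2)), f (c 0)⟫| := by
    rw [abs_mul, habs 0 (m + 2) (by omega) le_rfl, one_mul]
  rw [abs_of_nonpos (not_lt.1 hcon)] at h5
  simp only [Nat.add_assoc, Nat.reduceAdd] at *
  linarith


/-- The unsigned Gram matrix (with off-diagonal entries of size `0`, `1/2` or `√2/2`)
determines the family of spherical simplices `±f₁, …, ±f_{n+1}` uniquely up to isometry: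
two such systems of unit normals agree up to signs. -/
theorem diagram_unique_family {n : ℕ}
    (f g : Fin (n + 1) → EuclideanSpace ℝ (Fin (n + 1)))
    (hf_li : LinearIndependent ℝ f) (hg_li : LinearIndependent ℝ g)
    (hf_unit : ∀ i, ‖f i‖ = 1) (hg_unit : ∀ i, ‖g i‖ = 1)
    (habs : ∀ i j, i ≠ j → |⟪f i, f j⟫| = |⟪g i, g j⟫|)
    (hval : ∀ i j, i ≠ j →
      |⟪f i, f j⟫| ∈ ({0, 1 / 2, Real.sqrt 2 / 2} : Set ℝ)) :
    ∃ ε : Fin (n + 1) → ℝ, (∀ i, ε i = 1 ∨ ε i = -1) ∧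
      ∀ i j, ⟪g i, g j⟫ = ε i * ε j * ⟪f i, f j⟫ := by
  classical
  have hhalf : ∀ i j, i ≠ j → ⟪f i, f j⟫ ≠ 0 → 1 / 2 ≤ |⟪f i, f j⟫| := by
    intro i j hij h
    rcases hval i j hij with h1 | h1 | h1
    · exact absurd (abs_eq_zero.1 h1) h
    · exact h1.ge
    · rw [h1]
      have : (1 : ℝ) ≤ Real.sqrt 2 := Real.one_le_sqrt.2 (by norm_num)
      linarith
  let E : Fin (n + 1) → Fin (n + 1) → Prop := fun i j => i ≠ j ∧ ⟪f i, f j⟫ ≠ 0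
  let s : Fin (n + 1) → Fin (n + 1) → ℤˣ := fun i j => if ⟪f i, f j⟫ = ⟪g i, g j⟫ then 1 else -1
  have hE : ∀ u v, E u v → E v u := fun u v h => ⟨h.1.symm, by rw [real_inner_comm]; exact h.2⟩
  have hs : ∀ u v, s u v = s v u := by
    intro u v
    simp only [s]
    rw [real_inner_comm (f v), real_inner_comm (g v)]
  have hsg : ∀ u v, u ≠ v → ⟪g u, g v⟫ = ((s u v : ℤ) : ℝ) * ⟪f u, f v⟫ := by
    intro u v huv
    simp only [s]
    split_ifs with h
    · simp [h]
    · rcases abs_eq_abs.1 (habs u v huv) with h1 | h1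
      · exact absurd h1 h
      · simp [h1]
  have hun : ∀ t : ℤˣ, ((t : ℤ) : ℝ) * ((t : ℤ) : ℝ) = 1 := by
    intro t
    rcases Int.units_eq_one_or t with h | h <;> simp [h]
  have hb : ¬ ∃ k u, SWalk E s k u u (-1) := by
    intro hub
    obtain ⟨m, c, a, hm, ha0, hc, hcl, hcs, hinj, hch⟩ :=
      exists_induced_cycle hE hs (fun u h => h.1 rfl) hub
    let η : ℕ → ℝ := fun k => Nat.rec 1 (fun i r => if 0 < ⟪f (c i), f (c (i + 1))⟫ then -r else r) k
    have hηs : ∀ i, η (i + 1) = if 0 < ⟪f (c i), f (c (i + 1))⟫ then -η i else η i := fun i => rfl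
    have hη : ∀ i, η i = 1 ∨ η i = -1 := by
      intro i
      induction i with
      | zero => exact Or.inl rfl
      | succ i ih =>
        rw [hηs]
        split_ifs
        · rcases ih with h | h <;> simp [h]
        · exact ih
    have hsq : ∀ i, η i * η i = 1 := by
      intro i
      rcases hη i with h | h <;> simp [h]
    have hη' : ∀ i, i < m → η i * η (i + 1) * ⟪f (c i), f (c (i + 1))⟫ < 0 := by
      intro i hi
      have hne := (hc i hi).1.2
      rw [hηs]
      split_ifs with h
      · rw [mul_neg, hsq]
        linarith
      · rw [hsq, one_mul]
        exact lt_of_le_of_ne (not_lt.1 h) hne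
    have r1 := cycle_sign f hf_li hf_unit m hm c hinj
      (fun i hi => hhalf _ _ (hc i hi).1.1 (hc i hi).1.2) (hhalf _ _ hcl.1 hcl.2)
      (fun i j hij hj h => hch i j hij hj ⟨hinj i j (by omega) hj, h⟩) η (fun i _ => hη i) hη'
    have r2 := cycle_sign g hg_li hg_unit m hm c hinj
      (fun i hi => by
        rw [← habs _ _ (hc i hi).1.1]
        exact hhalf _ _ (hc i hi).1.1 (hc i hi).1.2)
      (by rw [← habs _ _ hcl.1]; exact hhalf _ _ hcl.1 hcl.2)
      (fun i j hij hj h => hch i j hij hj ⟨hinj i j (by omega) hj, fun h0 => h (by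
        rw [hsg _ _ (hinj i j (by omega) hj), h0, mul_zero])⟩)
      (fun i => η i * ((a i : ℤ) : ℝ))
      (fun i _ => by
        rcases hη i with h | h <;> rcases Int.units_eq_one_or (a i) with h' | h' <;> simp [h, h'])
      (fun i hi => by
        have h1 := hη' i hi
        obtain ⟨h2, h3⟩ := hc i hi
        rw [hsg _ _ h2.1, h3]
        push_cast
        have h4 := hun (a i)
        have h5 := hun (s (c i) (c (i + 1)))
        calc _ = (((a i : ℤ) : ℝ) * ((a i : ℤ) : ℝ)) * (((s (c i) (c (i + 1)) : ℤ) : ℝ) *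
              ((s (c i) (c (i + 1)) : ℤ) : ℝ)) *
              (η i * η (i + 1) * ⟪f (c i), f (c (i + 1))⟫) := by ring
          _ < 0 := by rw [h4, h5]; simpa using h1)
    simp only [ha0] at r2
    rw [hsg _ _ hcl.1] at r2
    have h6 : ((a m : ℤ) : ℝ) * ((s (c m) (c 0) : ℤ) : ℝ) = -1 := by
      rw [← Int.cast_mul, ← Units.val_mul, hcs]
      simp
    have h7 : η 0 * (((1 : ℤˣ) : ℤ) : ℝ) * (η m * ((a m : ℤ) : ℝ)) *
        (((s (c m) (c 0) : ℤ) : ℝ) * ⟪f (c m), f (c 0)⟫) =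
        (((a m : ℤ) : ℝ) * ((s (c m) (c 0) : ℤ) : ℝ)) * (η 0 * η m * ⟪f (c m), f (c 0)⟫) := by
      push_cast
      ring
    rw [h7, h6] at r2
    linarith
  obtain ⟨e, he⟩ := exists_switch hE hs hb
  refine ⟨fun i => ((e i : ℤ) : ℝ), fun i => ?_, fun i j => ?_⟩
  · rcases Int.units_eq_one_or (e i) with h | h <;> simp [h]
  · by_cases hij : i = j
    · subst hij
      rw [hun, real_inner_self_eq_norm_sq, real_inner_self_eq_norm_sq, hf_unit, hg_unit, one_mul]
    · rw [hsg i j hij]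
      by_cases h0 : ⟪f i, f j⟫ = 0
      · rw [h0, mul_zero, mul_zero]
      · rw [he i j ⟨hij, h0⟩]
        push_cast
        ring
end

section
/- Let G₁ and G₂ be connected simple graphs, each with n vertices and exactly n edges (hence each containing exactly one cycle). If the line graph of G₁ is isomorphic to the line graph of G₂, then G₁ is isomorphic to G₂. -/
namespace UniLG

open SimpleGraph

theorem closed_univ {V : Type*} {G : SimpleGraph V} (hc : G.Connected) (S : Set V) {x : V}
    (hx : x ∈ S) (hS : ∀ x ∈ S, ∀ y, G.Adj x y → y ∈ S) (y : V) : y ∈ S := by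
  obtain ⟨p⟩ := hc.preconnected x y
  induction p with
  | nil => exact hx
  | cons h p ih => exact ih (hS _ hx _ h)

theorem edge_ext {V : Type*} {e f : Sym2 V} {x y : V} (hxy : x ≠ y) (hx : x ∈ e) (hy : y ∈ e)
    (hx' : x ∈ f) (hy' : y ∈ f) : e = f := by
  rw [(Sym2.mem_and_mem_iff hxy).1 ⟨hx, hy⟩, (Sym2.mem_and_mem_iff hxy).1 ⟨hx', hy'⟩]

/-- every vertex is covered by an edge -/
def Cov {V : Type*} (G : SimpleGraph V) : Prop := ∀ v, ∃ e : G.edgeSet, v ∈ (e : Sym2 V)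

/-- vertices are determined by their stars -/
def Sep {V : Type*} (G : SimpleGraph V) : Prop :=
  ∀ v w, (∀ e : G.edgeSet, v ∈ (e : Sym2 V) ↔ w ∈ (e : Sym2 V)) → v = w

theorem cov_of {V : Type*} [Fintype V] {G : SimpleGraph V} (hc : G.Connected)
    (h : G.edgeSet.ncard = Fintype.card V) : Cov G := by
  intro v
  by_contra hv
  push Not at hv
  have hall : ∀ y, y ∈ ({v} : Set V) := by
    refine closed_univ hc {v} rfl ?_
    rintro x rfl y hxy
    exact absurd (Sym2.mem_mk_left x y) (hv ⟨s(x, y), hxy⟩)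
  have : G.edgeSet = ∅ := by
    ext e
    induction e with
    | _ x y =>
      have hx := hall x
      have hy := hall y
      simp only [Set.mem_singleton_iff] at hx hy
      subst hx; subst hy
      simp
  rw [this, Set.ncard_empty] at h
  have : 0 < Fintype.card V := Fintype.card_pos_iff.2 ⟨v⟩
  omega

theorem sep_of {V : Type*} [Fintype V] {G : SimpleGraph V} (hc : G.Connected)
    (h : G.edgeSet.ncard = Fintype.card V) : Sep G := by
  intro v w hvw
  by_contra hne
  have hall : ∀ y, y ∈ ({v, w} : Set V) := by
    refine closed_univ hc {v, w} (x := v) (by simp) ?_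
    intro x hx y hxy
    have h1 := hvw ⟨s(x, y), hxy⟩
    have := hxy.ne
    simp only [Sym2.mem_iff] at h1
    rcases hx with rfl | hx
    · simp at h1 ⊢; grind
    · rw [Set.mem_singleton_iff] at hx; subst hx
      simp at h1 ⊢; grind
  have hsub : G.edgeSet ⊆ {s(v, w)} := by
    intro e he
    induction e with
    | _ x y =>
      have hx := hall x
      have hy := hall y
      have := G.ne_of_adj he
      simp only [Set.mem_singleton_iff, Set.mem_insert_iff] at hx hy ⊢
      rw [Sym2.eq_iff]; grind
  have h1 := Set.ncard_le_ncard hsub (Set.finite_singleton _)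
  rw [Set.ncard_singleton] at h1
  have : 1 < Fintype.card V := Fintype.one_lt_card_iff.2 ⟨v, w, hne⟩
  omega

/-- preserves adjacency -/
def PA {V W : Type*} {G : SimpleGraph V} {H : SimpleGraph W} (φ : G.edgeSet ≃ H.edgeSet) : Prop :=
  ∀ e f : G.edgeSet, e ≠ f → (∃ v, v ∈ (e : Sym2 V) ∧ v ∈ (f : Sym2 V)) →
    ∃ w, w ∈ (φ e : Sym2 W) ∧ w ∈ (φ f : Sym2 W)

/-- preserves claws -/
def PC {V W : Type*} {G : SimpleGraph V} {H : SimpleGraph W} (φ : G.edgeSet ≃ H.edgeSet) : Prop :=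
  ∀ e f g : G.edgeSet, e ≠ f → e ≠ g → f ≠ g →
    (∃ v, v ∈ (e : Sym2 V) ∧ v ∈ (f : Sym2 V) ∧ v ∈ (g : Sym2 V)) →
    ∃ w, w ∈ (φ e : Sym2 W) ∧ w ∈ (φ f : Sym2 W) ∧ w ∈ (φ g : Sym2 W)

section
variable {V W : Type*} {G : SimpleGraph V} {H : SimpleGraph W}

theorem star_sub {φ : G.edgeSet ≃ H.edgeSet} (pa : PA φ) (pc : PC φ) {v : V} {e f : G.edgeSet}
    (hef : e ≠ f) (he : v ∈ (e : Sym2 V)) (hf : v ∈ (f : Sym2 V)) :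
    ∃ w, ∀ g : G.edgeSet, v ∈ (g : Sym2 V) → w ∈ (φ g : Sym2 W) := by
  obtain ⟨w, hwe, hwf⟩ := pa e f hef ⟨v, he, hf⟩
  refine ⟨w, fun g hg => ?_⟩
  by_cases hge : e = g
  · subst hge; exact hwe
  by_cases hgf : f = g
  · subst hgf; exact hwf
  obtain ⟨w', h1, h2, h3⟩ := pc e f g hef hge hgf ⟨v, he, hf, hg⟩
  by_cases hww : w = w'
  · subst hww; exact h3
  · exact absurd (φ.injective (Subtype.ext (edge_ext hww hwe h1 hwf h2))) hef

theorem star_eq {φ : G.edgeSet ≃ H.edgeSet} (pa : PA φ) (pc : PC φ) (pa' : PA φ.symm)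
    (pc' : PC φ.symm) {v : V} {e f : G.edgeSet}
    (hef : e ≠ f) (he : v ∈ (e : Sym2 V)) (hf : v ∈ (f : Sym2 V)) :
    ∃ w, ∀ g : G.edgeSet, v ∈ (g : Sym2 V) ↔ w ∈ (φ g : Sym2 W) := by
  obtain ⟨w, hw⟩ := star_sub pa pc hef he hf
  obtain ⟨v', hv'⟩ := star_sub pa' pc' (φ.injective.ne hef) (hw e he) (hw f hf)
  have key : ∀ g : G.edgeSet, w ∈ (φ g : Sym2 W) → v' ∈ (g : Sym2 V) := by
    intro g hg
    simpa using hv' (φ g) hg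
  have hvv : v = v' := by
    by_contra hne
    exact hef (Subtype.ext (edge_ext hne he (key e (hw e he)) hf (key f (hw f hf))))
  subst hvv
  exact ⟨w, fun g => ⟨hw g, key g⟩⟩

theorem star_ex {φ : G.edgeSet ≃ H.edgeSet} (cov : Cov G) (sep : Sep G)
    (pa : PA φ) (pc : PC φ) (pa' : PA φ.symm) (pc' : PC φ.symm) (v : V) :
    ∃ w, ∀ g : G.edgeSet, v ∈ (g : Sym2 V) ↔ w ∈ (φ g : Sym2 W) := by
  obtain ⟨e, he⟩ := cov v
  by_cases hd : ∃ f, e ≠ f ∧ v ∈ (f : Sym2 V)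
  · obtain ⟨f, hef, hf⟩ := hd
    exact star_eq pa pc pa' pc' hef he hf
  push Not at hd
  obtain ⟨u, hu⟩ := Sym2.mem_iff_exists.1 he
  have hue : u ∈ (e : Sym2 V) := by rw [hu]; simp
  have hvu : v ≠ u := by
    have := e.2
    rw [hu] at this
    exact G.ne_of_adj this
  have hf : ∃ f, e ≠ f ∧ u ∈ (f : Sym2 V) := by
    by_contra hcon
    push Not at hcon
    refine hvu (sep _ _ fun g => ?_)
    by_cases hg : e = g
    · subst hg; simp [he, hue]
    · simp [hd g hg, hcon g hg]
  obtain ⟨f, hef, hf⟩ := hf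
  obtain ⟨u', hu'⟩ := star_eq pa pc pa' pc' hef hue hf
  obtain ⟨v', hv'⟩ := Sym2.mem_iff_exists.1 ((hu' e).1 hue)
  have hve : v' ∈ (φ e : Sym2 W) := by rw [hv']; simp
  have hne : u' ≠ v' := by
    have := (φ e).2
    rw [hv'] at this
    exact H.ne_of_adj this
  refine ⟨v', fun g => ?_⟩
  by_cases hg : e = g
  · subst hg; simp [he, hve]
  refine iff_of_false (hd g hg) fun hvg => ?_
  obtain ⟨x, hx⟩ := star_eq (φ := φ.symm) pa' pc' (by simpa using pa) (by simpa using pc)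
    (φ.injective.ne hg) hve hvg
  have hxe : x ∈ (e : Sym2 V) := by simpa using (hx (φ e)).1 hve
  have hxg : x ∈ (g : Sym2 V) := by simpa using (hx (φ g)).1 hvg
  rw [hu, Sym2.mem_iff] at hxe
  rcases hxe with rfl | rfl
  · exact hd g hg hxg
  · exact hg (φ.injective (Subtype.ext (edge_ext hne ((hu' e).1 hue) hve ((hu' g).1 hxg) hvg)))

theorem iso_of {φ : G.edgeSet ≃ H.edgeSet} (cov : Cov G) (sep : Sep G) (cov' : Cov H)
    (sep' : Sep H)
    (pa : PA φ) (pc : PC φ) (pa' : PA φ.symm) (pc' : PC φ.symm) : Nonempty (G ≃g H) := by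
  choose F hF using star_ex cov sep pa pc pa' pc'
  choose K hK using star_ex (φ := φ.symm) cov' sep' pa' pc' (by simpa using pa) (by simpa using pc)
  refine ⟨⟨⟨F, K, fun v => sep _ _ fun e => ?_, fun w => sep' _ _ fun e => ?_⟩, ?_⟩⟩
  · rw [hF v e, hK (F v) (φ e)]; simp
  · rw [hK w e, hF (K w) (φ.symm e)]; simp
  · intro a b
    have hinj : Function.Injective F := by
      intro a b hab
      exact sep _ _ fun e => by rw [hF, hF, hab]
    constructor
    · intro h
      have hne := (hinj.ne_iff).1 (H.ne_of_adj h)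
      have h1 := (hF a (φ.symm ⟨s(F a, F b), h⟩)).2 (by simp)
      have h2 := (hF b (φ.symm ⟨s(F a, F b), h⟩)).2 (by simp)
      have h3 := (φ.symm ⟨s(F a, F b), h⟩).2
      rw [(Sym2.mem_and_mem_iff hne).1 ⟨h1, h2⟩] at h3
      exact h3
    · intro h
      have hne := hinj.ne (G.ne_of_adj h)
      have h1 := (hF a ⟨s(a, b), h⟩).1 (by simp)
      have h2 := (hF b ⟨s(a, b), h⟩).1 (by simp)
      have h3 := (φ ⟨s(a, b), h⟩).2
      rw [(Sym2.mem_and_mem_iff hne).1 ⟨h1, h2⟩] at h3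
      exact h3

end

/-- being a paw -/
def Paw {V : Type*} (G : SimpleGraph V) : Prop :=
  ∃ f : Fin 4 → V, Function.Bijective f ∧
    G.edgeSet = {s(f 0, f 1), s(f 0, f 2), s(f 1, f 2), s(f 0, f 3)}

theorem paw_iso {V W : Type*} {G : SimpleGraph V} {H : SimpleGraph W} (hG : Paw G) (hH : Paw H) :
    Nonempty (G ≃g H) := by
  obtain ⟨f, hf, hG⟩ := hG
  obtain ⟨g, hg, hH⟩ := hH
  have aG : ∀ i j, G.Adj (f i) (f j) ↔
      s(i, j) ∈ ({s(0, 1), s(0, 2), s(1, 2), s(0, 3)} : Set (Sym2 (Fin 4))) := by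
    intro i j
    rw [← G.mem_edgeSet, hG]
    simp [hf.1.eq_iff]
  have aH : ∀ i j, H.Adj (g i) (g j) ↔
      s(i, j) ∈ ({s(0, 1), s(0, 2), s(1, 2), s(0, 3)} : Set (Sym2 (Fin 4))) := by
    intro i j
    rw [← H.mem_edgeSet, hH]
    simp [hg.1.eq_iff]
  let ef := Equiv.ofBijective f hf
  let eg := Equiv.ofBijective g hg
  refine ⟨⟨ef.symm.trans eg, ?_⟩⟩
  intro a b
  obtain ⟨i, rfl⟩ := ef.surjective a
  obtain ⟨j, rfl⟩ := ef.surjective b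
  simp only [Equiv.trans_apply, Equiv.symm_apply_apply]
  exact (aH i j).trans (aG i j).symm

theorem paw_of {V : Type*} {G : SimpleGraph V} (p q r s : V) (hpq : G.Adj p q) (hpr : G.Adj p r)
    (hqr : G.Adj q r) (hps : G.Adj p s) (hqs : q ≠ s) (hrs : r ≠ s)
    (hall : ∀ x, x = p ∨ x = q ∨ x = r ∨ x = s) (hcard : G.edgeSet.ncard = 4) : Paw G := by
  have h1 := hpq.ne
  have h2 := hpr.ne
  have h3 := hqr.ne
  have h4 := hps.ne
  refine ⟨![p, q, r, s], ⟨?_, ?_⟩, ?_⟩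
  · intro i j
    fin_cases i <;> fin_cases j <;> simp_all [eq_comm]
  · intro x
    rcases hall x with rfl | rfl | rfl | rfl
    exacts [⟨0, rfl⟩, ⟨1, rfl⟩, ⟨2, rfl⟩, ⟨3, rfl⟩]
  · symm
    have hfin : G.edgeSet.Finite := Set.finite_of_ncard_ne_zero (by omega)
    apply Set.eq_of_subset_of_ncard_le _ _ hfin
    · rintro e (rfl | rfl | rfl | rfl) <;> assumption
    · rw [hcard]
      have : Set.ncard {s(p, q), s(p, r), s(q, r), s(p, s)} = 4 := by
        rw [Set.ncard_insert_of_notMem, Set.ncard_insert_of_notMem, Set.ncard_pair]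
        all_goals simp [Sym2.eq_iff]
        all_goals grind
      exact this.ge

set_option maxHeartbeats 1000000 in
theorem bad_case {V W : Type*} [Fintype V] [Fintype W] {G : SimpleGraph V} {H : SimpleGraph W}
    (hG : G.Connected) (hH : H.Connected) (hVW : Fintype.card V = Fintype.card W)
    (heG : G.edgeSet.ncard = Fintype.card V) (heH : H.edgeSet.ncard = Fintype.card W)
    {φ : G.edgeSet ≃ H.edgeSet} (pa : PA φ) (pa' : PA φ.symm) (pc : ¬ PC φ) :
    Paw G ∧ Paw H := by
  classical
  unfold PC at pc
  push Not at pc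
  obtain ⟨e, f, g, hef, heg, hfg, ⟨v, hve, hvf, hvg⟩, hno⟩ := pc
  obtain ⟨p, hpe, hpf⟩ := pa e f hef ⟨v, hve, hvf⟩
  obtain ⟨q, hqe, hqg⟩ := pa e g heg ⟨v, hve, hvg⟩
  obtain ⟨r, hrf, hrg⟩ := pa f g hfg ⟨v, hvf, hvg⟩
  have hpq : p ≠ q := by rintro rfl; exact hno _ hpe hpf hqg
  have hpr : p ≠ r := by rintro rfl; exact hno _ hpe hpf hrg
  have hqr : q ≠ r := by rintro rfl; exact hno _ hqe hrf hqg
  have e1 := (Sym2.mem_and_mem_iff hpq).1 ⟨hpe, hqe⟩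
  have f1 := (Sym2.mem_and_mem_iff hpr).1 ⟨hpf, hrf⟩
  have g1 := (Sym2.mem_and_mem_iff hqr).1 ⟨hqg, hrg⟩
  have apq : H.Adj p q := by have := (φ e).2; rwa [e1] at this
  have apr : H.Adj p r := by have := (φ f).2; rwa [f1] at this
  have aqr : H.Adj q r := by have := (φ g).2; rwa [g1] at this
  obtain ⟨a, ha⟩ := Sym2.mem_iff_exists.1 hve
  obtain ⟨b, hb⟩ := Sym2.mem_iff_exists.1 hvf
  obtain ⟨c, hc⟩ := Sym2.mem_iff_exists.1 hvg
  have ava : G.Adj v a := by have := e.2; rwa [ha] at this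
  have avb : G.Adj v b := by have := f.2; rwa [hb] at this
  have avc : G.Adj v c := by have := g.2; rwa [hc] at this
  have hab : a ≠ b := by rintro rfl; exact hef (Subtype.ext (ha.trans hb.symm))
  have hac : a ≠ c := by rintro rfl; exact heg (Subtype.ext (ha.trans hc.symm))
  have hbc : b ≠ c := by rintro rfl; exact hfg (Subtype.ext (hb.trans hc.symm))
  -- evenness
  have adj_iff : ∀ x y : G.edgeSet, x ≠ y → ((∃ u, u ∈ (x : Sym2 V) ∧ u ∈ (y : Sym2 V)) ↔
      ∃ u, u ∈ (φ x : Sym2 W) ∧ u ∈ (φ y : Sym2 W)) := by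
    intro x y hxy
    refine ⟨pa x y hxy, fun h => ?_⟩
    simpa using pa' (φ x) (φ y) (φ.injective.ne hxy) h
  have hallG : ∀ x, x ∈ ({v, a, b, c} : Set V) := by
    refine closed_univ hG _ (x := v) (by simp) ?_
    intro x hx y hxy
    by_contra hy
    simp only [Set.mem_insert_iff, Set.mem_singleton_iff, not_or] at hx hy
    obtain ⟨hyv, hya, hyb, hyc⟩ := hy
    let h : G.edgeSet := ⟨s(x, y), hxy⟩
    have hh : (h : Sym2 V) = s(x, y) := rfl
    have hhe : h ≠ e := by
      intro hx
      have : y ∈ (e : Sym2 V) := by rw [← hx, hh]; simp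
      rw [ha] at this; simp_all
    have hhf : h ≠ f := by
      intro hx
      have : y ∈ (f : Sym2 V) := by rw [← hx, hh]; simp
      rw [hb] at this; simp_all
    have hhg : h ≠ g := by
      intro hx
      have : y ∈ (g : Sym2 V) := by rw [← hx, hh]; simp
      rw [hc] at this; simp_all
    have he' : ((φ h : Sym2 W)) ≠ s(p, q) := by
      rw [← e1]; exact fun hx => hhe (φ.injective (Subtype.ext hx))
    have hf' : ((φ h : Sym2 W)) ≠ s(p, r) := by
      rw [← f1]; exact fun hx => hhf (φ.injective (Subtype.ext hx))
    have hg' : ((φ h : Sym2 W)) ≠ s(q, r) := by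
      rw [← g1]; exact fun hx => hhg (φ.injective (Subtype.ext hx))
    have te := adj_iff h e hhe
    have tf := adj_iff h f hhf
    have tg := adj_iff h g hhg
    rw [e1, hh, ha] at te
    rw [f1, hh, hb] at tf
    rw [g1, hh, hc] at tg
    generalize (φ h : Sym2 W) = z at *
    rw [ne_eq, ← Sym2.mem_and_mem_iff hpq] at he'
    rw [ne_eq, ← Sym2.mem_and_mem_iff hpr] at hf'
    rw [ne_eq, ← Sym2.mem_and_mem_iff hqr] at hg'
    simp only [Sym2.mem_iff, or_and_right, exists_or, exists_eq_left, and_or_left,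
      exists_eq_right] at te tf tg
    have := ava.ne
    have := avb.ne
    have := avc.ne
    rcases hx with rfl | rfl | rfl | rfl <;> grind
  have hcV : Fintype.card V = 4 := by
    have h1 : (Finset.univ : Finset V) = {v, a, b, c} := by
      ext x; simpa using hallG x
    rw [← Finset.card_univ, h1]
    have := ava.ne
    have := avb.ne
    have := avc.ne
    rw [Finset.card_insert_of_notMem, Finset.card_insert_of_notMem, Finset.card_pair]
    all_goals simp_all
  have hcW : Fintype.card W = 4 := by omega
  constructor
  · have hex : ∃ h ∈ G.edgeSet, h ∉ ({s(v, a), s(v, b), s(v, c)} : Set (Sym2 V)) := by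
      by_contra hcon
      push Not at hcon
      have h1 := Set.ncard_le_ncard (show G.edgeSet ⊆ _ from hcon) (Set.toFinite _)
      have h2 := Set.ncard_insert_le s(v, a) {s(v, b), s(v, c)}
      have h3 := Set.ncard_insert_le s(v, b) {s(v, c)}
      rw [Set.ncard_singleton] at h3
      omega
    obtain ⟨h, hh, hn⟩ := hex
    have key : G.Adj a b ∨ G.Adj a c ∨ G.Adj b c := by
      induction h with
      | _ x y =>
        rw [mem_edgeSet] at hh
        have hx := hallG x
        have hy := hallG y
        have := hh.ne
        have := hh.symm
        simp only [Set.mem_insert_iff, Set.mem_singleton_iff, not_or, Sym2.eq_iff] at hx hy hn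
        grind
    have hall : ∀ x, x = v ∨ x = a ∨ x = b ∨ x = c := fun x => by simpa using hallG x
    have h4 : G.edgeSet.ncard = 4 := by omega
    rcases key with k | k | k
    · exact paw_of v a b c ava avb k avc hac hbc hall h4
    · exact paw_of v a c b ava avc k avb hab hbc.symm (fun x => by have hx := hall x; clear * - hx; tauto) h4
    · exact paw_of v b c a avb avc k ava hab.symm hac.symm (fun x => by have hx := hall x; clear * - hx; tauto) h4
  · have h4 : H.edgeSet.ncard = 4 := by omega
    have hc3 : ({p, q, r} : Finset W).card = 3 := by
      rw [Finset.card_insert_of_notMem, Finset.card_pair hqr]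
      simp_all
    obtain ⟨s, hs⟩ : ∃ s, ({p, q, r} : Finset W)ᶜ = {s} := by
      rw [← Finset.card_eq_one, Finset.card_compl]; omega
    have hall : ∀ x, x = p ∨ x = q ∨ x = r ∨ x = s := by
      intro x
      by_cases hx : x ∈ ({p, q, r} : Finset W)
      · simp at hx; tauto
      · rw [← Finset.mem_compl, hs] at hx
        simp at hx; tauto
    have hsn : s ∉ ({p, q, r} : Finset W) := by
      rw [← Finset.mem_compl, hs]; simp
    simp only [Finset.mem_insert, Finset.mem_singleton, not_or] at hsn
    obtain ⟨s1, s2, s3⟩ := hsn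
    have key : H.Adj p s ∨ H.Adj q s ∨ H.Adj r s := by
      by_contra hcon
      push Not at hcon
      have := closed_univ hH {p, q, r} (x := p) (by simp) (by
        intro x hx y hxy
        have := hall y
        simp only [Set.mem_insert_iff, Set.mem_singleton_iff] at hx ⊢
        grind) s
      simp_all
    rcases key with k | k | k
    · exact paw_of p q r s apq apr aqr k (Ne.symm s2) (Ne.symm s3) hall h4
    · exact paw_of q p r s apq.symm aqr apr k (Ne.symm s1) (Ne.symm s3) (fun x => by have hx := hall x; clear * - hx; tauto) h4
    · exact paw_of r p q s apr.symm aqr.symm apq k (Ne.symm s1) (Ne.symm s2) (fun x => by have hx := hall x; clear * - hx; tauto) h4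

end UniLG

/-- Two connected unicyclic graphs (with `n` vertices and `n` edges each) with
isomorphic line graphs are isomorphic. -/
theorem unicyclic_of_lineGraph {V₁ V₂ : Type*} [Fintype V₁] [Fintype V₂] {n : ℕ}
    (G₁ : SimpleGraph V₁) (G₂ : SimpleGraph V₂)
    (h₁c : G₁.Connected) (h₂c : G₂.Connected)
    (hv₁ : Fintype.card V₁ = n) (hv₂ : Fintype.card V₂ = n)
    (he₁ : G₁.edgeSet.ncard = n) (he₂ : G₂.edgeSet.ncard = n)
    (hline : Nonempty (G₁.lineGraph ≃g G₂.lineGraph)) :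
    Nonempty (G₁ ≃g G₂) := by
  obtain ⟨ψ⟩ := hline
  have pa : UniLG.PA ψ.toEquiv := fun e f hef h =>
    (SimpleGraph.lineGraph_adj_iff_exists.1
      (ψ.map_rel_iff.2 (SimpleGraph.lineGraph_adj_iff_exists.2 ⟨hef, h⟩))).2
  have pa' : UniLG.PA ψ.toEquiv.symm := fun e f hef h =>
    (SimpleGraph.lineGraph_adj_iff_exists.1
      (ψ.symm.map_rel_iff.2 (SimpleGraph.lineGraph_adj_iff_exists.2 ⟨hef, h⟩))).2
  have e1 : G₁.edgeSet.ncard = Fintype.card V₁ := by omega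
  have e2 : G₂.edgeSet.ncard = Fintype.card V₂ := by omega
  by_cases pc : UniLG.PC ψ.toEquiv
  · by_cases pc' : UniLG.PC ψ.toEquiv.symm
    · exact UniLG.iso_of (UniLG.cov_of h₁c e1) (UniLG.sep_of h₁c e1) (UniLG.cov_of h₂c e2)
        (UniLG.sep_of h₂c e2) pa pc pa' pc'
    · obtain ⟨a, b⟩ := UniLG.bad_case h₂c h₁c (by omega) e2 e1 pa' (by simpa using pa) pc'
      exact UniLG.paw_iso b a
  · obtain ⟨a, b⟩ := UniLG.bad_case h₁c h₂c (by omega) e1 e2 pa pa' pc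
    exact UniLG.paw_iso a b
end

section
/- Let G₁ and G₂ be connected simple graphs on the vertex set Fin n, each with exactly n edges, with chosen non-bridge edges {a₁, b₁} in G₁ and {a₂, b₂} in G₂. Associate to each the vector family in EuclideanSpace ℝ (Fin n) assigning e_a + e_b to the chosen edge and e_i − e_j to every other edge. Then the following are equivalent: (1) G₁ and G₂ are isomorphic as graphs; (2) there exist a linear isometry T of EuclideanSpace ℝ (Fin n), a bijection φ from the edge set of G₁ to the edge set of G₂, and signs ε_e ∈ {−1, 1} such that the vector associated to φ(e) equals ε_e · T(vector associated to e) for every edge e of G₁. (Among simple graphs, the families of simplices generating D_n are in one-to-one correspondence with the connected graphs with n vertices containing exactly one cycle.) -/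
/-- The family of vectors attached to a graph with a chosen edge. -/
def IsFam {n : ℕ} (G : SimpleGraph (Fin n)) (a b : Fin n)
    (vec : G.edgeSet → EuclideanSpace ℝ (Fin n)) : Prop :=
  (∀ i j (h : s(i, j) ∈ G.edgeSet), s(i, j) ≠ s(a, b) →
    vec ⟨s(i, j), h⟩ = EuclideanSpace.single i 1 - EuclideanSpace.single j 1 ∨
    vec ⟨s(i, j), h⟩ = -(EuclideanSpace.single i 1 - EuclideanSpace.single j 1)) ∧
  (∀ i j (h : s(i, j) ∈ G.edgeSet), s(i, j) = s(a, b) →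
    vec ⟨s(i, j), h⟩ = EuclideanSpace.single i 1 + EuclideanSpace.single j 1)

theorem isFam_mk {n : ℕ} (G : SimpleGraph (Fin n)) (a b : Fin n)
    (hab : s(a, b) ∈ G.edgeSet)
    (vec : G.edgeSet → EuclideanSpace ℝ (Fin n))
    (h1 : vec ⟨s(a, b), hab⟩ =
      EuclideanSpace.single a 1 + EuclideanSpace.single b 1)
    (h2 : ∀ e : G.edgeSet, (e : Sym2 (Fin n)) ≠ s(a, b) →
      ∃ i j : Fin n, (e : Sym2 (Fin n)) = s(i, j) ∧
        vec e = EuclideanSpace.single i 1 - EuclideanSpace.single j 1) :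
    IsFam G a b vec := by
  constructor
  · intro i j h hne
    obtain ⟨k, l, hkl, hv⟩ := h2 ⟨s(i, j), h⟩ hne
    rw [hv]
    rcases Sym2.eq_iff.1 hkl with ⟨rfl, rfl⟩ | ⟨rfl, rfl⟩
    · left; rfl
    · right; simp
  · intro i j h he
    have : (⟨s(i, j), h⟩ : G.edgeSet) = ⟨s(a, b), hab⟩ := Subtype.ext he
    rw [this, h1]
    rcases Sym2.eq_iff.1 he with ⟨rfl, rfl⟩ | ⟨rfl, rfl⟩
    · rfl
    · rw [add_comm]

theorem IsFam.exists_signs {n : ℕ} {G : SimpleGraph (Fin n)} {a b : Fin n}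
    {vec : G.edgeSet → EuclideanSpace ℝ (Fin n)} (hF : IsFam G a b vec)
    (i j : Fin n) (h : s(i, j) ∈ G.edgeSet) :
    ∃ p q : ℝ, (p = 1 ∨ p = -1) ∧ (q = 1 ∨ q = -1) ∧
      vec ⟨s(i, j), h⟩ = p • EuclideanSpace.single i 1 + q • EuclideanSpace.single j 1 := by
  by_cases he : s(i, j) = s(a, b)
  · exact ⟨1, 1, Or.inl rfl, Or.inl rfl, by rw [hF.2 i j h he]; simp⟩
  · rcases hF.1 i j h he with h' | h'
    · exact ⟨1, -1, Or.inl rfl, Or.inr rfl, by rw [h', one_smul, neg_one_smul, sub_eq_add_neg]⟩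
    · exact ⟨-1, 1, Or.inr rfl, Or.inl rfl, by
        rw [h', one_smul, neg_one_smul, neg_sub, sub_eq_add_neg, add_comm]⟩

theorem IsFam.mem_iff {n : ℕ} {G : SimpleGraph (Fin n)} {a b : Fin n}
    {vec : G.edgeSet → EuclideanSpace ℝ (Fin n)} (hF : IsFam G a b vec)
    (e : G.edgeSet) (v : Fin n) : v ∈ (e : Sym2 (Fin n)) ↔ vec e v ≠ 0 := by
  obtain ⟨e, he⟩ := e
  induction e with
  | _ i j =>
  obtain ⟨p, q, hp, hq, hv⟩ := hF.exists_signs i j he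
  have hij : i ≠ j := G.ne_of_adj he
  rw [hv]
  have hp0 : p ≠ 0 := by rcases hp with rfl | rfl <;> norm_num
  have hq0 : q ≠ 0 := by rcases hq with rfl | rfl <;> norm_num
  by_cases h1 : v = i
  · subst h1; simp [hij, hp0]
  · by_cases h2 : v = j
    · subst h2; simp [h1, hq0]
    · simp [h1, h2]

theorem IsFam.inner_ne_iff {n : ℕ} {G : SimpleGraph (Fin n)} {a b : Fin n}
    {vec : G.edgeSet → EuclideanSpace ℝ (Fin n)} (hF : IsFam G a b vec)
    (e f : G.edgeSet) : inner ℝ (vec e) (vec f) ≠ 0 ↔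
      ∃ v, v ∈ (e : Sym2 (Fin n)) ∧ v ∈ (f : Sym2 (Fin n)) := by
  constructor
  · intro h
    by_contra hcon
    apply h
    rw [PiLp.inner_apply]
    apply Finset.sum_eq_zero
    intro v _
    by_cases hv : v ∈ (e : Sym2 (Fin n))
    · have : vec f v = 0 := by
        by_contra h0
        exact hcon ⟨v, hv, (hF.mem_iff f v).2 h0⟩
      simp [this]
    · have : vec e v = 0 := by
        by_contra h0
        exact hv ((hF.mem_iff e v).2 h0)
      simp [this]
  · rintro ⟨v, hve, hvf⟩
    by_cases hef : e = f
    · subst hef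
      intro h0
      rw [inner_self_eq_zero] at h0
      exact (hF.mem_iff e v).1 hve (by rw [h0]; rfl)
    · rw [PiLp.inner_apply, Finset.sum_eq_single v]
      · have h1 := (hF.mem_iff e v).1 hve
        have h2 := (hF.mem_iff f v).1 hvf
        simp [h1, h2]
      · intro w _ hw
        by_contra h0
        have hwe : w ∈ (e : Sym2 (Fin n)) := by
          rw [hF.mem_iff]; intro h; apply h0; simp [h]
        have hwf : w ∈ (f : Sym2 (Fin n)) := by
          rw [hF.mem_iff]; intro h; apply h0; simp [h]
        apply hef
        apply Subtype.ext
        rw [(Sym2.mem_and_mem_iff hw).1 ⟨hwe, hve⟩, (Sym2.mem_and_mem_iff hw).1 ⟨hwf, hvf⟩]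
      · simp

theorem IsFam.int_coord {n : ℕ} {G : SimpleGraph (Fin n)} {a b : Fin n}
    {vec : G.edgeSet → EuclideanSpace ℝ (Fin n)} (hF : IsFam G a b vec)
    (e : G.edgeSet) (v : Fin n) : ∃ z : ℤ, vec e v = z := by
  obtain ⟨e, he⟩ := e
  induction e with
  | _ i j =>
  obtain ⟨p, q, hp, hq, hv⟩ := hF.exists_signs i j he
  have aux : ∀ p : ℝ, p = 1 ∨ p = -1 → ∃ z : ℤ, p = z := by
    rintro p (rfl | rfl)
    · exact ⟨1, by simp⟩
    · exact ⟨-1, by simp⟩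
  obtain ⟨P, rfl⟩ := aux p hp
  obtain ⟨Q, rfl⟩ := aux q hq
  refine ⟨P * (if v = i then 1 else 0) + Q * (if v = j then 1 else 0), ?_⟩
  rw [hv]
  simp

theorem rel_of_reachable {V : Type*} {G : SimpleGraph V} {R : V → V → Prop}
    (hr : ∀ x, R x x) (ht : ∀ x y z, R x y → R y z → R x z)
    (ha : ∀ x y, G.Adj x y → R x y) {x y : V} (h : G.Reachable x y) : R x y := by
  obtain ⟨w⟩ := h
  induction w with
  | nil => exact hr _
  | cons h _ ih => exact ht _ _ _ (ha _ _ h) ih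

theorem IsFam.two_single_mem {n : ℕ} {G : SimpleGraph (Fin n)} {a b : Fin n}
    {vec : G.edgeSet → EuclideanSpace ℝ (Fin n)} (hF : IsFam G a b vec)
    (hc : G.Connected) (hab : s(a, b) ∈ G.edgeSet) (hnb : ¬ G.IsBridge s(a, b)) (i : Fin n) :
    (2 : ℝ) • EuclideanSpace.single i (1 : ℝ) ∈ AddSubgroup.closure (Set.range vec) := by
  have hc' := hc.connected_delete_edge_of_not_isBridge hnb
  have key : ∀ x y : Fin n, EuclideanSpace.single x (1 : ℝ) - EuclideanSpace.single y (1 : ℝ) ∈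
      AddSubgroup.closure (Set.range vec) := by
    intro x y
    refine rel_of_reachable (R := fun x y => EuclideanSpace.single x (1 : ℝ) -
      EuclideanSpace.single y (1 : ℝ) ∈ AddSubgroup.closure (Set.range vec)) ?_ ?_ ?_
      (hc'.preconnected x y)
    · intro x; simp
    · intro x y z h1 h2
      simpa using AddSubgroup.add_mem _ h1 h2
    · intro x y hxy
      rw [SimpleGraph.deleteEdges_adj] at hxy
      have hm := AddSubgroup.subset_closure (Set.mem_range_self (f := vec) ⟨s(x, y), hxy.1⟩)
      rcases hF.1 x y hxy.1 hxy.2 with h | h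
      · rwa [h] at hm
      · rw [h] at hm; exact neg_mem_iff.1 hm
  have h3 := AddSubgroup.subset_closure (Set.mem_range_self (f := vec) ⟨s(a, b), hab⟩)
  rw [hF.2 a b hab rfl] at h3
  have := AddSubgroup.add_mem _ (AddSubgroup.add_mem _ (key i a) (key i b)) h3
  convert this using 1
  rw [two_smul]; abel

theorem int_vec_aux {n : ℕ} (hn : n ≠ 4) (z : Fin n → ℤ) (hs : ∑ i, z i ^ 2 = 4)
    (hp : ∀ j k, Even (z j) → Even (z k)) :
    ∃ j, (z j = 2 ∨ z j = -2) ∧ ∀ k, k ≠ j → z k = 0 := by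
  by_cases hodd : ∃ j, ¬ Even (z j)
  · exfalso
    obtain ⟨j, hj⟩ := hodd
    have h1 : ∀ k, ∃ w : ℤ, 0 ≤ w ∧ z k ^ 2 = 8 * w + 1 := by
      intro k
      have : Odd (z k) := Int.not_even_iff_odd.1 (fun h => hj (hp k j h))
      have h8 := Int.sq_mod_four_eq_one_of_odd this
      obtain ⟨m, hm⟩ := this
      obtain ⟨t, ht⟩ := Int.even_mul_succ_self m
      refine ⟨t, ?_, ?_⟩
      · have : 0 ≤ m * (m + 1) := by
          rcases le_or_gt 0 m with h | h
          · positivity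
          · nlinarith
        omega
      · rw [hm]; linear_combination 4 * ht
    choose w hw0 hw using h1
    simp only [hw, Finset.sum_add_distrib, ← Finset.mul_sum] at hs
    have := Finset.sum_nonneg (fun i (_ : i ∈ Finset.univ) => hw0 i)
    simp at hs
    omega
  · push Not at hodd
    choose w hw using hodd
    have hw' : ∀ k, z k ^ 2 = 4 * w k ^ 2 := by intro k; rw [hw k]; ring
    simp only [hw', ← Finset.mul_sum] at hs
    have hs1 : ∑ i, w i ^ 2 = 1 := by omega
    obtain ⟨j, -, hj⟩ : ∃ j ∈ Finset.univ, w j ^ 2 ≠ 0 := by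
      apply Finset.exists_ne_zero_of_sum_ne_zero
      rw [hs1]; norm_num
    have hj1 : 1 ≤ w j ^ 2 := by have := sq_nonneg (w j); omega
    rw [← Finset.add_sum_erase _ _ (Finset.mem_univ j)] at hs1
    have hnn : 0 ≤ ∑ x ∈ Finset.univ.erase j, w x ^ 2 := Finset.sum_nonneg fun i _ => sq_nonneg _
    have hz : ∑ x ∈ Finset.univ.erase j, w x ^ 2 = 0 := by omega
    have hj2 : w j ^ 2 = 1 := by omega
    refine ⟨j, ?_, ?_⟩
    · rw [hw j]
      rcases mul_self_eq_one_iff.1 ((sq (w j)).symm.trans hj2) with h | h <;> simp [h]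
    · intro k hk
      have := (Finset.sum_eq_zero_iff_of_nonneg (fun i _ => sq_nonneg (w i))).1 hz k
        (Finset.mem_erase.2 ⟨hk, Finset.mem_univ k⟩)
      rw [hw k, pow_eq_zero_iff (by norm_num)] at *
      simp [this]

/-- adjacency on four vertices from six booleans -/
def adj4 (b01 b02 b03 b12 b13 b23 : Bool) : Fin 4 → Fin 4 → Bool :=
  ![![false, b01, b02, b03], ![b01, false, b12, b13], ![b02, b12, false, b23],
    ![b03, b13, b23, false]]

set_option maxRecDepth 100000 in
theorem adj4_aux : ∀ b01 b02 b03 b12 b13 b23 : Bool,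
    b01.toNat + b02.toNat + b03.toNat + b12.toNat + b13.toNat + b23.toNat = 4 →
    ∃ π : Equiv.Perm (Fin 4), ∀ i j, adj4 b01 b02 b03 b12 b13 b23 i j =
     (if (∃ i j, adj4 b01 b02 b03 b12 b13 b23 i j = true ∧ ∀ k l,
       adj4 b01 b02 b03 b12 b13 b23 k l = true → (k = i ∨ k = j ∨ l = i ∨ l = j)) then
       adj4 true true true true false false else
       adj4 true false true true false true) (π i) (π j) := by
  decide

open Classical in
theorem four_aux (G : SimpleGraph (Fin 4)) (he : G.edgeSet.ncard = 4) :
    ∃ π : Equiv.Perm (Fin 4), ∀ i j, G.Adj i j ↔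
     (if (∃ e ∈ G.edgeSet, ∀ f ∈ G.edgeSet, ∃ v, v ∈ e ∧ v ∈ f) then
       adj4 true true true true false false else
       adj4 true false true true false true) (π i) (π j) = true := by
  have hA : ∀ i j, adj4 (decide (G.Adj 0 1)) (decide (G.Adj 0 2)) (decide (G.Adj 0 3))
      (decide (G.Adj 1 2)) (decide (G.Adj 1 3)) (decide (G.Adj 2 3)) i j = true ↔ G.Adj i j := by
    intro i j
    fin_cases i <;> fin_cases j <;> simp [adj4] <;> exact G.adj_comm _ _
  have hcount : (decide (G.Adj 0 1)).toNat + (decide (G.Adj 0 2)).toNat +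
      (decide (G.Adj 0 3)).toNat + (decide (G.Adj 1 2)).toNat + (decide (G.Adj 1 3)).toNat +
      (decide (G.Adj 2 3)).toNat = 4 := by
    have h1 := G.sum_degrees_eq_twice_card_edges
    rw [← SimpleGraph.coe_edgeFinset, Set.ncard_coe_finset] at he
    rw [he] at h1
    have hd : ∀ v, G.degree v = ∑ w, (decide (G.Adj v w)).toNat := by
      intro v
      rw [← SimpleGraph.card_neighborFinset_eq_degree, SimpleGraph.neighborFinset_eq_filter,
        Finset.card_filter]
      apply Finset.sum_congr rfl
      intro w _
      by_cases h : G.Adj v w <;> simp [h]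
    simp only [hd, Fin.sum_univ_four, SimpleGraph.irrefl, G.adj_comm 1 0, G.adj_comm 2 0,
      G.adj_comm 3 0, G.adj_comm 2 1, G.adj_comm 3 1, G.adj_comm 3 2] at h1
    simp only [decide_false, Bool.toNat_false] at h1
    omega
  obtain ⟨π, hπ⟩ := adj4_aux _ _ _ _ _ _ hcount
  refine ⟨π, fun i j => ?_⟩
  rw [← hA, hπ]
  have hiff : (∃ i j, G.Adj i j ∧ ∀ k l, G.Adj k l → (k = i ∨ k = j ∨ l = i ∨ l = j)) ↔
      (∃ e ∈ G.edgeSet, ∀ f ∈ G.edgeSet, ∃ v, v ∈ e ∧ v ∈ f) := by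
    simp only [Sym2.exists, Sym2.forall, SimpleGraph.mem_edgeSet, Sym2.mem_iff]
    constructor
    · rintro ⟨i, j, h, h'⟩
      refine ⟨i, j, h, fun k l hkl => ?_⟩
      rcases h' k l hkl with h | h | h | h
      · exact ⟨k, by simp [h]⟩
      · exact ⟨k, by simp [h]⟩
      · exact ⟨l, by simp [h]⟩
      · exact ⟨l, by simp [h]⟩
    · rintro ⟨i, j, h, h'⟩
      refine ⟨i, j, h, fun k l hkl => ?_⟩
      obtain ⟨v, h1, h2⟩ := h' k l hkl
      rcases h1 with rfl | rfl <;> rcases h2 with rfl | rfl <;> simp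
  simp only [hA, hiff]

theorem four_iso (G H : SimpleGraph (Fin 4)) (hG : G.edgeSet.ncard = 4)
    (hH : H.edgeSet.ncard = 4)
    (h : (∃ e ∈ G.edgeSet, ∀ f ∈ G.edgeSet, ∃ v, v ∈ e ∧ v ∈ f) ↔
      (∃ e ∈ H.edgeSet, ∀ f ∈ H.edgeSet, ∃ v, v ∈ e ∧ v ∈ f)) : Nonempty (G ≃g H) := by
  obtain ⟨π, hπ⟩ := four_aux G hG
  obtain ⟨ρ, hρ⟩ := four_aux H hH
  refine ⟨⟨π.trans ρ.symm, ?_⟩⟩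
  intro i j
  rw [hρ, hπ]
  simp only [Equiv.trans_apply, Equiv.apply_symm_apply]
  by_cases hP : ∃ e ∈ G.edgeSet, ∀ f ∈ G.edgeSet, ∃ v, v ∈ e ∧ v ∈ f
  · rw [if_pos hP, if_pos (h.1 hP)]
  · rw [if_neg hP, if_neg (fun h' => hP (h.2 h'))]

theorem backward_four (G₁ G₂ : SimpleGraph (Fin 4)) (a₁ b₁ a₂ b₂ : Fin 4)
    (he₁ : G₁.edgeSet.ncard = 4) (he₂ : G₂.edgeSet.ncard = 4)
    (vec₁ : G₁.edgeSet → EuclideanSpace ℝ (Fin 4))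
    (vec₂ : G₂.edgeSet → EuclideanSpace ℝ (Fin 4))
    (h₁ : IsFam G₁ a₁ b₁ vec₁) (h₂ : IsFam G₂ a₂ b₂ vec₂)
    (T : EuclideanSpace ℝ (Fin 4) ≃ₗᵢ[ℝ] EuclideanSpace ℝ (Fin 4))
    (φ : G₁.edgeSet ≃ G₂.edgeSet) (ε : G₁.edgeSet → ℝ)
    (hε : ∀ e, ε e = 1 ∨ ε e = -1) (hT : ∀ e, vec₂ (φ e) = ε e • T (vec₁ e)) :
    Nonempty (G₁ ≃g G₂) := by
  have hε0 : ∀ e, ε e ≠ 0 := by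
    intro e; rcases hε e with h | h <;> rw [h] <;> norm_num
  have key : ∀ e f : G₁.edgeSet,
      (∃ v, v ∈ (e : Sym2 (Fin 4)) ∧ v ∈ (f : Sym2 (Fin 4))) ↔
      (∃ v, v ∈ (φ e : Sym2 (Fin 4)) ∧ v ∈ (φ f : Sym2 (Fin 4))) := by
    intro e f
    rw [← h₁.inner_ne_iff, ← h₂.inner_ne_iff, hT, hT, inner_smul_left, inner_smul_right,
      T.inner_map_map]
    simp [hε0]
  apply four_iso G₁ G₂ he₁ he₂
  constructor
  · rintro ⟨e, he, h⟩
    refine ⟨φ ⟨e, he⟩, (φ ⟨e, he⟩).2, fun f hf => ?_⟩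
    have := (key ⟨e, he⟩ (φ.symm ⟨f, hf⟩)).1 (h _ (φ.symm ⟨f, hf⟩).2)
    simpa using this
  · rintro ⟨e, he, h⟩
    refine ⟨φ.symm ⟨e, he⟩, (φ.symm ⟨e, he⟩).2, fun f hf => ?_⟩
    apply (key (φ.symm ⟨e, he⟩) ⟨f, hf⟩).2
    simpa using h _ (φ ⟨f, hf⟩).2

theorem backward_gen {n : ℕ} (hn : n ≠ 4) (G₁ G₂ : SimpleGraph (Fin n)) (a₁ b₁ a₂ b₂ : Fin n)
    (h₁c : G₁.Connected) (h₂c : G₂.Connected)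
    (hab₁ : s(a₁, b₁) ∈ G₁.edgeSet) (hnb₁ : ¬ G₁.IsBridge s(a₁, b₁))
    (vec₁ : G₁.edgeSet → EuclideanSpace ℝ (Fin n))
    (vec₂ : G₂.edgeSet → EuclideanSpace ℝ (Fin n))
    (h₁ : IsFam G₁ a₁ b₁ vec₁) (h₂ : IsFam G₂ a₂ b₂ vec₂)
    (T : EuclideanSpace ℝ (Fin n) ≃ₗᵢ[ℝ] EuclideanSpace ℝ (Fin n))
    (φ : G₁.edgeSet ≃ G₂.edgeSet) (ε : G₁.edgeSet → ℝ)
    (hε : ∀ e, ε e = 1 ∨ ε e = -1) (hT : ∀ e, vec₂ (φ e) = ε e • T (vec₁ e)) :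
    Nonempty (G₁ ≃g G₂) := by
  have hT' : ∀ e, T (vec₁ e) = ε e • vec₂ (φ e) := by
    intro e; rw [hT]; rcases hε e with h | h <;> simp [h]
  have hεz : ∀ e, ∃ z : ℤ, ε e = z := by
    intro e; rcases hε e with h | h
    · exact ⟨1, by simp [h]⟩
    · exact ⟨-1, by simp [h]⟩
  -- integrality of the vectors of the second family
  have hint2 := h₂.int_coord
  have hint1 := h₁.int_coord
  have hintT : ∀ x ∈ AddSubgroup.closure (Set.range vec₁), ∀ j, ∃ z : ℤ, T x j = z := by
    intro x hx
    induction hx using AddSubgroup.closure_induction with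
    | mem x hx =>
      obtain ⟨e, rfl⟩ := hx
      intro j
      obtain ⟨z, hz⟩ := hint2 (φ e) j
      obtain ⟨w, hw⟩ := hεz e
      exact ⟨w * z, by rw [hT']; simp [hz, hw]⟩
    | zero => intro j; exact ⟨0, by simp⟩
    | add x y _ _ hx hy =>
      intro j
      obtain ⟨z, hz⟩ := hx j
      obtain ⟨w, hw⟩ := hy j
      exact ⟨z + w, by simp [hz, hw]⟩
    | neg x _ hx =>
      intro j
      obtain ⟨z, hz⟩ := hx j
      exact ⟨-z, by simp [hz]⟩
  have main : ∀ i, ∃ k, ∃ s : ℝ, (s = 1 ∨ s = -1) ∧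
      T (EuclideanSpace.single i 1) = s • EuclideanSpace.single k 1 := by
    intro i
    have hx := hintT _ (h₁.two_single_mem h₁c hab₁ hnb₁ i)
    choose z hz using hx
    have hs : ∑ j, z j ^ 2 = 4 := by
      have h1 : ‖T ((2 : ℝ) • EuclideanSpace.single i (1 : ℝ))‖ ^ 2 = 4 := by
        rw [T.norm_map, norm_smul]; simp; norm_num
      rw [EuclideanSpace.norm_sq_eq] at h1
      simp only [hz, Real.norm_eq_abs, sq_abs] at h1
      exact_mod_cast h1
    have hpar : ∀ j k, Even (z j) → Even (z k) := by
      intro j k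
      refine rel_of_reachable (R := fun j k => Even (z j) → Even (z k)) (fun _ h => h)
        (fun _ _ _ h h' h'' => h' (h h'')) ?_ (h₂c.preconnected j k)
      intro x y hxy
      obtain ⟨e, hee⟩ := φ.surjective ⟨s(x, y), hxy⟩
      obtain ⟨p, q, hp, hq, hv⟩ := h₂.exists_signs x y hxy
      have hin : inner ℝ (T ((2 : ℝ) • EuclideanSpace.single i (1 : ℝ))) (vec₂ (φ e)) =
          2 * (ε e * vec₁ e i) := by
        rw [hT, inner_smul_right, T.inner_map_map, inner_smul_left,
          EuclideanSpace.inner_single_left]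
        simp; ring
      rw [hee, hv, inner_add_right, inner_smul_right, inner_smul_right,
        EuclideanSpace.inner_single_right, EuclideanSpace.inner_single_right, hz, hz] at hin
      obtain ⟨m, hm⟩ := hint1 e i
      obtain ⟨w, hw⟩ := hεz e
      rw [hm, hw] at hin
      simp only [one_mul, conj_trivial] at hin
      intro ⟨t, ht⟩
      rcases hp with rfl | rfl <;> rcases hq with rfl | rfl
      · have : 1 * z x + 1 * z y = 2 * (w * m) := by exact_mod_cast hin
        exact ⟨w * m - t, by omega⟩
      · have : 1 * z x + (-1) * z y = 2 * (w * m) := by exact_mod_cast hin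
        exact ⟨t - w * m, by omega⟩
      · have : (-1) * z x + 1 * z y = 2 * (w * m) := by exact_mod_cast hin
        exact ⟨w * m + t, by omega⟩
      · have : (-1) * z x + (-1) * z y = 2 * (w * m) := by exact_mod_cast hin
        exact ⟨- (w * m) - t, by omega⟩
    obtain ⟨k, hk, hk'⟩ := int_vec_aux hn z hs hpar
    refine ⟨k, (z k : ℝ) / 2, ?_, ?_⟩
    · rcases hk with h | h <;> rw [h] <;> norm_num
    · ext j
      have := hz j
      rw [map_smul] at this
      simp only [PiLp.smul_apply, smul_eq_mul] at this
      by_cases hjk : j = k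
      · subst hjk; simp; linarith
      · rw [hk' j hjk] at this
        simp [hjk]; simpa using this
  choose π s hs hπ using main
  have hs0 : ∀ i, s i ≠ 0 := by
    intro i; rcases hs i with h | h <;> rw [h] <;> norm_num
  have hinj : Function.Injective π := by
    intro i j hij
    by_contra hne
    have h1 : inner ℝ (T (EuclideanSpace.single i 1)) (T (EuclideanSpace.single j 1)) = 0 := by
      rw [T.inner_map_map, EuclideanSpace.inner_single_left]; simp [hne]
    rw [hπ, hπ, hij, inner_smul_left, inner_smul_right, EuclideanSpace.inner_single_left] at h1
    simp [hs0] at h1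
  have hφ : ∀ e : G₁.edgeSet, (φ e : Sym2 (Fin n)) = Sym2.map π e := by
    rintro ⟨e, he⟩
    induction e with
    | _ i j =>
    have hij : i ≠ j := G₁.ne_of_adj he
    have hπij : π i ≠ π j := fun h => hij (hinj h)
    obtain ⟨p, q, hp, hq, hv⟩ := h₁.exists_signs i j he
    have hp0 : p ≠ 0 := by rcases hp with rfl | rfl <;> norm_num
    have hq0 : q ≠ 0 := by rcases hq with rfl | rfl <;> norm_num
    have hε0 : ε ⟨s(i, j), he⟩ ≠ 0 := by
      rcases hε ⟨s(i, j), he⟩ with h | h <;> rw [h] <;> norm_num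
    have hm : ∀ v, v ∈ (Sym2.map π s(i, j)) → v ∈ (φ ⟨s(i, j), he⟩ : Sym2 (Fin n)) := by
      intro v hv'
      rw [h₂.mem_iff, hT, hv, map_add, map_smul, map_smul, hπ, hπ]
      rw [Sym2.map_mk, Sym2.mem_iff] at hv'
      rcases hv' with rfl | rfl
      · simp [hπij, hp0, hε0, hs0]
      · simp [hπij.symm, hq0, hε0, hs0]
    exact (Sym2.mem_and_mem_iff hπij).1 ⟨hm _ (by simp), hm _ (by simp)⟩
  refine ⟨⟨Equiv.ofBijective π (Finite.injective_iff_bijective.1 hinj), ?_⟩⟩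
  intro i j
  simp only [Equiv.ofBijective_apply]
  constructor
  · intro h
    obtain ⟨e, hee⟩ := φ.surjective ⟨s(π i, π j), h⟩
    have h1 := hφ e
    rw [hee] at h1
    have h2 : (e : Sym2 (Fin n)) = s(i, j) := by
      apply Sym2.map.injective hinj
      rw [← h1]; rfl
    have := e.2
    rwa [h2] at this
  · intro h
    have h1 := hφ ⟨s(i, j), h⟩
    have h2 := (φ ⟨s(i, j), h⟩).2
    rw [h1] at h2
    exact h2

theorem card_delete {n : ℕ} (G : SimpleGraph (Fin n)) (hc : G.Connected)
    (he : G.edgeSet.ncard = n) (e : Sym2 (Fin n)) (hme : e ∈ G.edgeSet)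
    (hnb : ¬ G.IsBridge e) : (G.deleteEdges {e}).IsTree := by
  rw [SimpleGraph.isTree_iff_connected_and_card]
  induction e with
  | _ x y =>
  refine ⟨hc.connected_delete_edge_of_not_isBridge hnb, ?_⟩
  rw [Nat.card_coe_set_eq, SimpleGraph.edgeSet_deleteEdges,
    Set.ncard_sdiff_singleton_add_one hme (Set.toFinite _), he, Nat.card_fin]

theorem reach_or {V : Type*} {K : SimpleGraph V} (hK : K.Connected) (a b v : V) :
    (K.deleteEdges {s(a, b)}).Reachable a v ∨ (K.deleteEdges {s(a, b)}).Reachable b v := by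
  refine rel_of_reachable (G := K) (R := fun x y =>
    ((K.deleteEdges {s(a, b)}).Reachable a x ∨ (K.deleteEdges {s(a, b)}).Reachable b x) →
    ((K.deleteEdges {s(a, b)}).Reachable a y ∨ (K.deleteEdges {s(a, b)}).Reachable b y))
    (fun _ h => h) (fun _ _ _ h h' h'' => h' (h h'')) ?_ (hK.preconnected a v)
    (Or.inl (SimpleGraph.Reachable.refl _))
  intro x y hxy h
  by_cases hc : s(x, y) = s(a, b)
  · rcases Sym2.eq_iff.1 hc with ⟨rfl, rfl⟩ | ⟨rfl, rfl⟩
    · right; exact SimpleGraph.Reachable.refl _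
    · left; exact SimpleGraph.Reachable.refl _
  · have : (K.deleteEdges {s(a, b)}).Adj x y := by
      rw [SimpleGraph.deleteEdges_adj]; exact ⟨hxy, hc⟩
    exact h.imp (fun h => h.trans this.reachable) (fun h => h.trans this.reachable)

/-- The switching function. -/
theorem exists_switch_s17 {n : ℕ} (G : SimpleGraph (Fin n)) (hc : G.Connected)
    (he : G.edgeSet.ncard = n) (a b c d : Fin n)
    (hab : s(a, b) ∈ G.edgeSet) (hcd : s(c, d) ∈ G.edgeSet)
    (hnab : ¬ G.IsBridge s(a, b)) (hncd : ¬ G.IsBridge s(c, d)) (hne : s(a, b) ≠ s(c, d)) :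
    ∃ σ : Fin n → ℝ, (∀ i, σ i = 1 ∨ σ i = -1) ∧
      (∀ i j, G.Adj i j → s(i, j) ≠ s(a, b) → s(i, j) ≠ s(c, d) → σ i = σ j) ∧
      σ a = - σ b ∧ σ c = - σ d := by
  classical
  have t1 := card_delete G hc he _ hab hnab
  have t2 := card_delete G hc he _ hcd hncd
  have b1 := SimpleGraph.isAcyclic_iff_forall_adj_isBridge.1 t1.isAcyclic
    (v := c) (w := d) (by rw [SimpleGraph.deleteEdges_adj]; exact ⟨hcd, hne.symm⟩)
  have b2 := SimpleGraph.isAcyclic_iff_forall_adj_isBridge.1 t2.isAcyclic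
    (v := a) (w := b) (by rw [SimpleGraph.deleteEdges_adj]; exact ⟨hab, hne⟩)
  rw [SimpleGraph.isBridge_iff, SimpleGraph.deleteEdges_deleteEdges, Set.union_comm,
    ← SimpleGraph.deleteEdges_deleteEdges] at b1
  rw [SimpleGraph.isBridge_iff] at b2
  have hro := reach_or t2.1 a b
  set H := (G.deleteEdges {s(c, d)}).deleteEdges {s(a, b)} with hH
  refine ⟨fun i => if H.Reachable a i then 1 else -1, ?_, ?_, ?_, ?_⟩
  · intro i; by_cases h : H.Reachable a i <;> simp [h]
  · intro i j hij h1 h2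
    have hadj : H.Adj i j := by
      rw [hH, SimpleGraph.deleteEdges_adj, SimpleGraph.deleteEdges_adj]
      exact ⟨⟨hij, h2⟩, h1⟩
    have : H.Reachable a i ↔ H.Reachable a j :=
      ⟨fun h => h.trans hadj.reachable, fun h => h.trans hadj.symm.reachable⟩
    simp only [this]
  · simp [b2]
  · by_cases h1 : H.Reachable a c
    · have h2 : ¬ H.Reachable a d := fun h => b1 (h1.symm.trans h)
      simp [h1, h2]
    · have h2 : H.Reachable a d := by
        by_contra h2
        exact b1 (((hro c).resolve_left h1).symm.trans ((hro d).resolve_left h2))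
      simp [h1, h2]

theorem forward {n : ℕ} (G₁ G₂ : SimpleGraph (Fin n)) (a₁ b₁ a₂ b₂ : Fin n)
    (h₁c : G₁.Connected)
    (he₁ : G₁.edgeSet.ncard = n)
    (hab₁ : s(a₁, b₁) ∈ G₁.edgeSet) (hab₂ : s(a₂, b₂) ∈ G₂.edgeSet)
    (hnb₁ : ¬ G₁.IsBridge s(a₁, b₁)) (hnb₂ : ¬ G₂.IsBridge s(a₂, b₂))
    (vec₁ : G₁.edgeSet → EuclideanSpace ℝ (Fin n))
    (vec₂ : G₂.edgeSet → EuclideanSpace ℝ (Fin n))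
    (h₁ : IsFam G₁ a₁ b₁ vec₁) (h₂ : IsFam G₂ a₂ b₂ vec₂) (f : G₁ ≃g G₂) :
      ∃ (T : EuclideanSpace ℝ (Fin n) ≃ₗᵢ[ℝ] EuclideanSpace ℝ (Fin n))
        (φ : G₁.edgeSet ≃ G₂.edgeSet) (ε : G₁.edgeSet → ℝ),
        (∀ e, ε e = 1 ∨ ε e = -1) ∧
        ∀ e, vec₂ (φ e) = ε e • T (vec₁ e) := by
  -- the switching function
  have hσ : ∃ σ : Fin n → ℝ, (∀ i, σ i = 1 ∨ σ i = -1) ∧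
      (∀ i j, G₁.Adj i j → (s(i, j) = s(a₁, b₁) ↔ s(f i, f j) = s(a₂, b₂)) → σ i = σ j) ∧
      (∀ i j, G₁.Adj i j → ¬ (s(i, j) = s(a₁, b₁) ↔ s(f i, f j) = s(a₂, b₂)) → σ i = - σ j) := by
    have hfs : ∀ i j, s(f i, f j) = s(a₂, b₂) ↔ s(i, j) = s(f.symm a₂, f.symm b₂) := by
      intro i j
      have e1 : s(f i, f j) = Sym2.map f s(i, j) := rfl
      have e2 : s(a₂, b₂) = Sym2.map f s(f.symm a₂, f.symm b₂) := by simp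
      rw [e1, e2]
      exact (Sym2.map.injective f.injective).eq_iff
    by_cases hne : s(a₁, b₁) = s(f.symm a₂, f.symm b₂)
    · refine ⟨fun _ => 1, fun _ => Or.inl rfl, fun _ _ _ _ => rfl, ?_⟩
      intro i j _ h
      exact absurd (by rw [hfs, hne]) h
    · have hcd : s(f.symm a₂, f.symm b₂) ∈ G₁.edgeSet := by
        rw [SimpleGraph.mem_edgeSet, f.symm.map_adj_iff]; exact hab₂
      have hncd : ¬ G₁.IsBridge s(f.symm a₂, f.symm b₂) := by
        rw [SimpleGraph.isBridge_iff, not_not]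
        rw [SimpleGraph.isBridge_iff, not_not] at hnb₂
        let g : (G₂.deleteEdges {s(a₂, b₂)}) →g
            (G₁.deleteEdges {s(f.symm a₂, f.symm b₂)}) :=
          ⟨f.symm, by
            intro x y hxy
            rw [SimpleGraph.deleteEdges_adj] at hxy ⊢
            refine ⟨f.symm.map_adj_iff.2 hxy.1, fun h => hxy.2 ?_⟩
            have := (hfs (f.symm x) (f.symm y)).2 h
            simpa using this⟩
        exact hnb₂.map g
      obtain ⟨σ, s1, s2, s3, s4⟩ :=
        exists_switch_s17 G₁ h₁c he₁ _ _ _ _ hab₁ hcd hnb₁ hncd hne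
      refine ⟨σ, s1, ?_, ?_⟩
      · intro i j hij h
        rw [hfs] at h
        by_cases h' : s(i, j) = s(a₁, b₁)
        · exact absurd (h'.symm.trans (h.1 h')) hne
        · exact s2 i j hij h' (fun h'' => h' (h.2 h''))
      · intro i j hij h
        rw [hfs] at h
        by_cases h' : s(i, j) = s(a₁, b₁)
        · rcases Sym2.eq_iff.1 h' with ⟨rfl, rfl⟩ | ⟨rfl, rfl⟩
          · exact s3
          · rw [s3, neg_neg]
        · have h'' : s(i, j) = s(f.symm a₂, f.symm b₂) := by tauto
          rcases Sym2.eq_iff.1 h'' with ⟨rfl, rfl⟩ | ⟨rfl, rfl⟩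
          · exact s4
          · rw [s4, neg_neg]
  obtain ⟨σ, s1, s2, s3⟩ := hσ
  let T : EuclideanSpace ℝ (Fin n) ≃ₗᵢ[ℝ] EuclideanSpace ℝ (Fin n) :=
    (LinearIsometryEquiv.piLpCongrRight 2 (fun i : Fin n =>
      if σ i = 1 then LinearIsometryEquiv.refl ℝ ℝ else LinearIsometryEquiv.neg ℝ)).trans
    (LinearIsometryEquiv.piLpCongrLeft 2 ℝ ℝ f.toEquiv)
  have hTs : ∀ i, T (EuclideanSpace.single i 1) = σ i • EuclideanSpace.single (f i) 1 := by
    intro i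
    have h1 : (-1 : ℝ) ≠ 1 := by norm_num
    simp only [T, LinearIsometryEquiv.trans_apply, EuclideanSpace.single,
      LinearIsometryEquiv.piLpCongrRight_single, LinearIsometryEquiv.piLpCongrLeft_single]
    rcases s1 i with h | h
    · simp [h]
    · simp [h, h1, PiLp.single_neg]
  have key : ∀ e, ∃ ε : ℝ, (ε = 1 ∨ ε = -1) ∧ vec₂ (f.mapEdgeSet e) = ε • T (vec₁ e) := by
    rintro ⟨e, he⟩
    induction e with
    | _ i j =>
    have he' : s(f i, f j) ∈ G₂.edgeSet := f.map_adj_iff.2 he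
    have hm : f.mapEdgeSet ⟨s(i, j), he⟩ = ⟨s(f i, f j), he'⟩ := rfl
    suffices h : vec₂ ⟨s(f i, f j), he'⟩ = T (vec₁ ⟨s(i, j), he⟩) ∨
        vec₂ ⟨s(f i, f j), he'⟩ = - T (vec₁ ⟨s(i, j), he⟩) by
      rw [hm]
      rcases h with h | h
      · exact ⟨1, Or.inl rfl, by rw [h, one_smul]⟩
      · exact ⟨-1, Or.inr rfl, by rw [h, neg_one_smul]⟩
    by_cases c1 : s(i, j) = s(a₁, b₁) <;> by_cases c2 : s(f i, f j) = s(a₂, b₂)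
    · rw [h₁.2 _ _ he c1, h₂.2 _ _ he' c2, map_add, hTs, hTs, s2 i j he (by tauto)]
      rcases s1 j with h | h <;> rw [h] <;> first | (left; module) | (right; module)
    · rw [h₁.2 _ _ he c1, map_add, hTs, hTs, s3 i j he (by tauto)]
      rcases h₂.1 _ _ he' c2 with h' | h' <;> rw [h'] <;> rcases s1 j with h | h <;> rw [h] <;>
        first | (left; module) | (right; module)
    · rw [h₂.2 _ _ he' c2]
      rcases h₁.1 _ _ he c1 with h' | h' <;>
        rw [h'] <;> simp only [map_neg, map_sub] <;> rw [hTs, hTs, s3 i j he (by tauto)] <;>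
        rcases s1 j with h | h <;> rw [h] <;> first | (left; module) | (right; module)
    · rcases h₂.1 _ _ he' c2 with h'' | h'' <;> rcases h₁.1 _ _ he c1 with h' | h' <;>
        rw [h', h''] <;> simp only [map_neg, map_sub] <;> rw [hTs, hTs, s2 i j he (by tauto)] <;>
        rcases s1 j with h | h <;> rw [h] <;> first | (left; module) | (right; module)
  choose ε hε hv using key
  exact ⟨T, f.mapEdgeSet, ε, hε, hv⟩


/-- Among simple graphs, the families of simplices generating `Dₙ` are in one-to-one
correspondence with the connected graphs with `n` vertices containing exactly one
cycle: two connected unicyclic graphs on `Fin n` are isomorphic if and only if their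
associated vector families (`e_a + e_b` for a chosen non-bridge edge `{a, b}` and
`eᵢ - eⱼ` for every other edge) agree up to a linear isometry, a bijection of the
edge sets, and signs. -/
theorem Dn_families_iff_unicyclic_graphs {n : ℕ}
    (G₁ G₂ : SimpleGraph (Fin n))
    (h₁c : G₁.Connected) (h₂c : G₂.Connected)
    (he₁ : G₁.edgeSet.ncard = n) (he₂ : G₂.edgeSet.ncard = n)
    (a₁ b₁ a₂ b₂ : Fin n)
    (hab₁ : s(a₁, b₁) ∈ G₁.edgeSet) (hab₂ : s(a₂, b₂) ∈ G₂.edgeSet)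
    (hnb₁ : ¬ G₁.IsBridge s(a₁, b₁)) (hnb₂ : ¬ G₂.IsBridge s(a₂, b₂))
    (vec₁ : G₁.edgeSet → EuclideanSpace ℝ (Fin n))
    (vec₂ : G₂.edgeSet → EuclideanSpace ℝ (Fin n))
    (hvec₁_ab : vec₁ ⟨s(a₁, b₁), hab₁⟩ =
      EuclideanSpace.single a₁ 1 + EuclideanSpace.single b₁ 1)
    (hvec₁ : ∀ e : G₁.edgeSet, (e : Sym2 (Fin n)) ≠ s(a₁, b₁) →
      ∃ i j : Fin n, (e : Sym2 (Fin n)) = s(i, j) ∧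
        vec₁ e = EuclideanSpace.single i 1 - EuclideanSpace.single j 1)
    (hvec₂_ab : vec₂ ⟨s(a₂, b₂), hab₂⟩ =
      EuclideanSpace.single a₂ 1 + EuclideanSpace.single b₂ 1)
    (hvec₂ : ∀ e : G₂.edgeSet, (e : Sym2 (Fin n)) ≠ s(a₂, b₂) →
      ∃ i j : Fin n, (e : Sym2 (Fin n)) = s(i, j) ∧
        vec₂ e = EuclideanSpace.single i 1 - EuclideanSpace.single j 1) :
    Nonempty (G₁ ≃g G₂) ↔
      ∃ (T : EuclideanSpace ℝ (Fin n) ≃ₗᵢ[ℝ] EuclideanSpace ℝ (Fin n))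
        (φ : G₁.edgeSet ≃ G₂.edgeSet) (ε : G₁.edgeSet → ℝ),
        (∀ e, ε e = 1 ∨ ε e = -1) ∧
        ∀ e, vec₂ (φ e) = ε e • T (vec₁ e) := by
  have F₁ := isFam_mk G₁ a₁ b₁ hab₁ vec₁ hvec₁_ab hvec₁
  have F₂ := isFam_mk G₂ a₂ b₂ hab₂ vec₂ hvec₂_ab hvec₂
  constructor
  · rintro ⟨f⟩
    exact forward G₁ G₂ a₁ b₁ a₂ b₂ h₁c he₁ hab₁ hab₂ hnb₁ hnb₂ vec₁ vec₂ F₁ F₂ f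
  · rintro ⟨T, φ, ε, hε, hT⟩
    by_cases hn : n = 4
    · subst hn
      exact backward_four G₁ G₂ a₁ b₁ a₂ b₂ he₁ he₂ vec₁ vec₂ F₁ F₂ T φ ε hε hT
    · exact backward_gen hn G₁ G₂ a₁ b₁ a₂ b₂ h₁c h₂c hab₁ hnb₁ vec₁ vec₂ F₁ F₂ T φ ε hε hT
end
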